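/- Let ε ≥ 0 and let u be a smooth sphere-valued ε-harmonic map defined on an open neighbourhood of the closed unit disk in ℝ². Then for all 0 < p < q < 1: ∫_{A(p,q)} |∇u|² dx = 2 ∫_{A(p,q)} |x|^{−2}|∂_θ u|² dx + 2ε ∫_p^q t^{−1} ( ∫_{B_t} |Δu|² dx ) dt − 2ε ∫_{A(p,q)} ( ½|Δu|² + ∑_{i=1}^{2} ⟨∂_i u, ∂_i Δu⟩ − 2⟨∂_r u, ∂_r(Δu)⟩ ) dx. -/

import Mathlib

open scoped RealInnerProductSpace
open Filter MeasureTheory Metric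

noncomputable section

/-- The plane `ℝ²` as a Euclidean space. -/
abbrev E2 : Type := EuclideanSpace ℝ (Fin 2)

/-- Euclidean space `ℝ^l`. -/
abbrev Eu (l : ℕ) : Type := EuclideanSpace ℝ (Fin l)

/-- Partial derivative `∂_α u` of a map `u : ℝ² → ℝ^l`. -/
def pd {l : ℕ} (α : Fin 2) (u : E2 → Eu l) (x : E2) : Eu l :=
  fderiv ℝ u x (EuclideanSpace.single α 1)

/-- Partial derivative `∂_α f` of a scalar function `f : ℝ² → ℝ`. -/
def pds (α : Fin 2) (f : E2 → ℝ) (x : E2) : ℝ :=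
  fderiv ℝ f x (EuclideanSpace.single α 1)

/-- The componentwise Laplacian `Δu = ∂₁∂₁u + ∂₂∂₂u`. -/
def lap {l : ℕ} (u : E2 → Eu l) (x : E2) : Eu l :=
  pd 0 (pd 0 u) x + pd 1 (pd 1 u) x

/-- `|∇u|² = |∂₁u|² + |∂₂u|²`. -/
def gradSq {l : ℕ} (u : E2 → Eu l) (x : E2) : ℝ :=
  ‖pd 0 u x‖ ^ 2 + ‖pd 1 u x‖ ^ 2

/-- The harmonic stress-energy tensor `S¹_{αβ}(u) = ½|∇u|²δ_{αβ} − ⟨∂_α u, ∂_β u⟩`. -/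
def S1 {l : ℕ} (u : E2 → Eu l) (α β : Fin 2) (x : E2) : ℝ :=
  (1 / 2) * gradSq u x * (if α = β then 1 else 0) - ⟪pd α u x, pd β u x⟫

/-- Jiang's biharmonic stress-energy tensor
`S²_{αβ}(u) = ½|Δu|²δ_{αβ} + ∑_γ ⟨∂_γ u, ∂_γ Δu⟩ δ_{αβ} − ⟨∂_α u, ∂_β Δu⟩ − ⟨∂_β u, ∂_α Δu⟩`. -/
def S2 {l : ℕ} (u : E2 → Eu l) (α β : Fin 2) (x : E2) : ℝ :=
  (1 / 2) * ‖lap u x‖ ^ 2 * (if α = β then 1 else 0)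
    + (∑ γ : Fin 2, ⟪pd γ u x, pd γ (lap u) x⟫) * (if α = β then 1 else 0)
    - ⟪pd α u x, pd β (lap u) x⟫ - ⟪pd β u x, pd α (lap u) x⟫

/-- A sphere-valued map `u : Ω → S^{l-1} ⊂ ℝ^l` is `ε`-harmonic if `Δu − εΔ²u` is a real
scalar multiple of `u` at every point of `Ω` (the Euler–Lagrange equation of the ε-energy). -/
def IsEpsHarmonic {l : ℕ} (ε : ℝ) (Ω : Set E2) (u : E2 → Eu l) : Prop :=
  ∀ x ∈ Ω, ∃ c : ℝ, lap u x - ε • lap (lap u) x = c • u x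

/-- The point `(a, b) ∈ ℝ²`. -/
def pt (a b : ℝ) : E2 := (WithLp.equiv 2 (Fin 2 → ℝ)).symm ![a, b]

/-- The radial derivative `∂_r u(x) = Du(x)[x/|x|]`. -/
def radialDeriv {l : ℕ} (u : E2 → Eu l) (x : E2) : Eu l :=
  fderiv ℝ u x (‖x‖⁻¹ • x)

/-- The angular derivative `∂_θ u(x) = Du(x)[(-x₂, x₁)]`, so that
`|∇u|² = |∂_r u|² + |x|⁻²|∂_θ u|²`. -/
def angularDeriv {l : ℕ} (u : E2 → Eu l) (x : E2) : Eu l :=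
  fderiv ℝ u x (pt (-(x 1)) (x 0))

/-- The circle integral `∫_{∂B_t} f dS = ∫₀^{2π} f(t cos θ, t sin θ) t dθ`. -/
def circInt (t : ℝ) (f : E2 → ℝ) : ℝ :=
  ∫ θ in (0:ℝ)..(2 * Real.pi), f (pt (t * Real.cos θ) (t * Real.sin θ)) * t

/-- The open annulus `A(p,q) = {x ∈ ℝ² : p < |x| < q}`. -/
def ann (p q : ℝ) : Set E2 := {x : E2 | p < ‖x‖ ∧ ‖x‖ < q}

/-! ### Partial derivatives and the Pohozaev vector field -/

lemma contDiff_pd {l : ℕ} {u : E2 → Eu l} (hu : ContDiff ℝ (⊤ : ℕ∞) u) (α : Fin 2) :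
    ContDiff ℝ (⊤ : ℕ∞) (pd α u) :=
  (hu.fderiv_right (m := ((⊤ : ℕ∞) : WithTop ℕ∞)) le_rfl).clm_apply contDiff_const

lemma contDiff_lap {l : ℕ} {u : E2 → Eu l} (hu : ContDiff ℝ (⊤ : ℕ∞) u) :
    ContDiff ℝ (⊤ : ℕ∞) (lap u) :=
  (contDiff_pd (contDiff_pd hu 0) 0).add (contDiff_pd (contDiff_pd hu 1) 1)

lemma pd_comm {l : ℕ} {u : E2 → Eu l} (hu : ContDiff ℝ (⊤ : ℕ∞) u) (α β : Fin 2) (x : E2) :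
    pd α (pd β u) x = pd β (pd α u) x := by
  have hd : DifferentiableAt ℝ (fderiv ℝ u) x :=
    ((hu.fderiv_right (m := ((⊤ : ℕ∞) : WithTop ℕ∞)) le_rfl).differentiable (by simp)) x
  have hsymm : IsSymmSndFDerivAt ℝ u x :=
    hu.contDiffAt.isSymmSndFDerivAt (by
      rw [minSmoothness_of_isRCLikeNormedField]; exact WithTop.coe_le_coe.2 le_top)
  have key : ∀ α β : Fin 2, pd α (pd β u) x =
      fderiv ℝ (fderiv ℝ u) x (EuclideanSpace.single α 1) (EuclideanSpace.single β 1) := by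
    intro α β
    change fderiv ℝ (fun y => fderiv ℝ u y (EuclideanSpace.single β 1)) x _ = _
    rw [fderiv_clm_apply hd (differentiableAt_const _)]
    simp
  rw [key, key]
  exact hsymm _ _

lemma hasDerivAt_line_pd {l : ℕ} {w : E2 → Eu l} (hw : ContDiff ℝ (⊤ : ℕ∞) w) (γ : Fin 2)
    (x : E2) :
    HasDerivAt (fun t : ℝ => w (x + t • EuclideanSpace.single γ (1 : ℝ))) (pd γ w x) 0 :=
  ((hw.differentiable (by simp)) x).hasFDerivAt.hasLineDerivAt _

lemma hasDerivAt_line_inner {l : ℕ} {v w : E2 → Eu l} (hv : ContDiff ℝ (⊤ : ℕ∞) v)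
    (hw : ContDiff ℝ (⊤ : ℕ∞) w) (γ : Fin 2) (x : E2) :
    HasDerivAt (fun t : ℝ => ⟪v (x + t • EuclideanSpace.single γ (1 : ℝ)),
        w (x + t • EuclideanSpace.single γ (1 : ℝ))⟫)
      (⟪v x, pd γ w x⟫ + ⟪pd γ v x, w x⟫) 0 := by
  have := (hasDerivAt_line_pd hv γ x).inner ℝ (hasDerivAt_line_pd hw γ x)
  simpa using this

lemma hasDerivAt_line_S1 {l : ℕ} {u : E2 → Eu l} (hu : ContDiff ℝ (⊤ : ℕ∞) u)
    (α β γ : Fin 2) (x : E2) :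
    HasDerivAt (fun t : ℝ => S1 u α β (x + t • EuclideanSpace.single γ (1 : ℝ)))
      ((1 / 2) * ((⟪pd 0 u x, pd γ (pd 0 u) x⟫ + ⟪pd γ (pd 0 u) x, pd 0 u x⟫)
          + (⟪pd 1 u x, pd γ (pd 1 u) x⟫ + ⟪pd γ (pd 1 u) x, pd 1 u x⟫))
          * (if α = β then 1 else 0)
        - (⟪pd α u x, pd γ (pd β u) x⟫ + ⟪pd γ (pd α u) x, pd β u x⟫)) 0 := by
  have h := fun i j => hasDerivAt_line_inner (contDiff_pd hu i) (contDiff_pd hu j) γ x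
  have := ((((h 0 0).add (h 1 1)).const_mul (1 / 2 : ℝ)).mul_const
    (if α = β then (1 : ℝ) else 0)).sub (h α β)
  simp only [S1, gradSq, ← real_inner_self_eq_norm_sq]
  exact this

lemma hasDerivAt_line_S2 {l : ℕ} {u : E2 → Eu l} (hu : ContDiff ℝ (⊤ : ℕ∞) u)
    (α β γ : Fin 2) (x : E2) :
    HasDerivAt (fun t : ℝ => S2 u α β (x + t • EuclideanSpace.single γ (1 : ℝ)))
      ((1 / 2) * (⟪lap u x, pd γ (lap u) x⟫ + ⟪pd γ (lap u) x, lap u x⟫)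
          * (if α = β then 1 else 0)
        + ((⟪pd 0 u x, pd γ (pd 0 (lap u)) x⟫ + ⟪pd γ (pd 0 u) x, pd 0 (lap u) x⟫)
          + (⟪pd 1 u x, pd γ (pd 1 (lap u)) x⟫ + ⟪pd γ (pd 1 u) x, pd 1 (lap u) x⟫))
          * (if α = β then 1 else 0)
        - (⟪pd α u x, pd γ (pd β (lap u)) x⟫ + ⟪pd γ (pd α u) x, pd β (lap u) x⟫)
        - (⟪pd β u x, pd γ (pd α (lap u)) x⟫ + ⟪pd γ (pd β u) x, pd α (lap u) x⟫)) 0 := by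
  have hL := contDiff_lap hu
  have h := fun i j => hasDerivAt_line_inner (contDiff_pd hu i) (contDiff_pd hL j) γ x
  have := (((((hasDerivAt_line_inner hL hL γ x).const_mul (1 / 2 : ℝ)).mul_const
    (if α = β then (1 : ℝ) else 0)).add (((h 0 0).add (h 1 1)).mul_const
    (if α = β then (1 : ℝ) else 0))).sub (h α β)).sub (h β α)
  simp only [S2, Fin.sum_univ_two, ← real_inner_self_eq_norm_sq]
  exact this

/-- The Pohozaev vector field `F_α = ∑_β x_β (S¹_{αβ}(u) − ε S²_{αβ}(u))`. -/
def pohozaevField {l : ℕ} (ε : ℝ) (u : E2 → Eu l) (α : Fin 2) (x : E2) : ℝ :=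
  x 0 * (S1 u α 0 x - ε * S2 u α 0 x) + x 1 * (S1 u α 1 x - ε * S2 u α 1 x)

lemma contDiff_pohozaevField {l : ℕ} {u : E2 → Eu l} (hu : ContDiff ℝ (⊤ : ℕ∞) u)
    (ε : ℝ) (α : Fin 2) : ContDiff ℝ (⊤ : ℕ∞) (pohozaevField ε u α) := by
  have hL := contDiff_lap hu
  have h1 := fun i => contDiff_pd hu i
  have h2 := fun i => contDiff_pd hL i
  have hx : ∀ i : Fin 2, ContDiff ℝ (⊤ : ℕ∞) (fun x : E2 => x i) := fun i => by fun_prop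
  have hS1 : ∀ i j, ContDiff ℝ (⊤ : ℕ∞) (S1 u i j) := fun i j =>
    ((contDiff_const.mul (((h1 0).norm_sq ℝ).add ((h1 1).norm_sq ℝ))).mul contDiff_const).sub
      ((h1 i).inner ℝ (h1 j))
  have hS2 : ∀ i j, ContDiff ℝ (⊤ : ℕ∞) (S2 u i j) := fun i j =>
    ((((contDiff_const.mul (hL.norm_sq ℝ)).mul contDiff_const).add
      ((ContDiff.sum fun γ _ => (h1 γ).inner ℝ (h2 γ)).mul contDiff_const)).sub
      ((h1 i).inner ℝ (h2 j))).sub ((h1 j).inner ℝ (h2 i))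
  exact ((hx 0).mul ((hS1 α 0).sub (contDiff_const.mul (hS2 α 0)))).add
    ((hx 1).mul ((hS1 α 1).sub (contDiff_const.mul (hS2 α 1))))

lemma pd_eq_zero_of_notMem_tsupport {l : ℕ} {u : E2 → Eu l} {x : E2} (hx : x ∉ tsupport u)
    (α : Fin 2) : pd α u x = 0 := by
  have := fderiv_of_notMem_tsupport (𝕜 := ℝ) hx
  simp [pd, this]

lemma tsupport_pd_subset {l : ℕ} (u : E2 → Eu l) (α : Fin 2) : tsupport (pd α u) ⊆ tsupport u :=
  closure_minimal (fun x hx => by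
    by_contra h
    exact hx (pd_eq_zero_of_notMem_tsupport h α)) (isClosed_tsupport u)

lemma lap_eq_zero_of_notMem_tsupport {l : ℕ} {u : E2 → Eu l} {x : E2} (hx : x ∉ tsupport u) :
    lap u x = 0 := by
  simp [lap, pd_eq_zero_of_notMem_tsupport fun h => hx (tsupport_pd_subset u _ h)]

lemma hasCompactSupport_pohozaevField {l : ℕ} {u : E2 → Eu l} (hc : HasCompactSupport u)
    (ε : ℝ) (α : Fin 2) : HasCompactSupport (pohozaevField ε u α) :=
  HasCompactSupport.intro hc fun x hx => by
    simp [pohozaevField, S1, S2, gradSq, pd_eq_zero_of_notMem_tsupport hx,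
      lap_eq_zero_of_notMem_tsupport hx]

/-- The divergence of the Pohozaev field is the trace of the stress-energy tensor wherever
`Δu − εΔ²u` is orthogonal to the derivatives of `u`. -/
lemma lineDeriv_pohozaevField_add {l : ℕ} {u : E2 → Eu l} (hu : ContDiff ℝ (⊤ : ℕ∞) u)
    (ε : ℝ) (x : E2) (hx : ∀ α, ⟪pd α u x, lap u x - ε • lap (lap u) x⟫ = 0) :
    lineDeriv ℝ (pohozaevField ε u 0) x (EuclideanSpace.single 0 1)
      + lineDeriv ℝ (pohozaevField ε u 1) x (EuclideanSpace.single 1 1)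
      = -ε * ‖lap u x‖ ^ 2 := by
  have hcoord : ∀ i j : Fin 2, HasDerivAt
      (fun t : ℝ => (x + t • EuclideanSpace.single j (1 : ℝ)) i) (if i = j then 1 else 0) 0 := by
    intro i j
    have h : HasDerivAt (fun t : ℝ => (x + t • EuclideanSpace.single j (1 : ℝ)) i) _ 0 :=
      ((hasDerivAt_id (0 : ℝ)).mul_const
        ((EuclideanSpace.single j (1 : ℝ) : E2) i)).const_add (x i)
    exact h.congr_deriv (by simp)
  have hT := fun α β γ : Fin 2 =>
    (hcoord β γ).mul ((hasDerivAt_line_S1 hu α β γ x).sub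
      ((hasDerivAt_line_S2 hu α β γ x).const_mul ε))
  have hF : ∀ α : Fin 2, HasLineDerivAt ℝ (pohozaevField ε u α) _ x
    (EuclideanSpace.single α 1) := fun α => (hT α 0 α).add (hT α 1 α)
  have e0 := hx 0
  have e1 := hx 1
  have c := pd_comm hu 1 0 x
  have c' := pd_comm (contDiff_lap hu) 1 0 x
  rw [(hF 0).lineDeriv, (hF 1).lineDeriv]
  simp only [inner_sub_right, inner_smul_right] at e0 e1
  rw [show lap (lap u) x = pd 0 (pd 0 (lap u)) x + pd 1 (pd 1 (lap u)) x from rfl] at e0 e1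
  have hl : lap u x = pd 0 (pd 0 u) x + pd 1 (pd 1 u) x := rfl
  have d : ∀ i, ⟪pd i (lap u) x, lap u x⟫
      = ⟪pd i (lap u) x, pd 0 (pd 0 u) x⟫ + ⟪pd i (lap u) x, pd 1 (pd 1 u) x⟫ :=
    fun i => by rw [← inner_add_right, ← hl]
  have d' : ∀ i, ⟪pd i u x, lap u x⟫
      = ⟪pd i u x, pd 0 (pd 0 u) x⟫ + ⟪pd i u x, pd 1 (pd 1 u) x⟫ :=
    fun i => by rw [← inner_add_right, ← hl]
  rw [inner_add_right, d'] at e0 e1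
  simp [S1, S2, gradSq, c, c', Fin.sum_univ_two]
  have s1 : ∀ i j k, ⟪pd j (pd k u) x, pd i u x⟫ = ⟪pd i u x, pd j (pd k u) x⟫ :=
    fun i j k => real_inner_comm _ _
  have s2 : ∀ i j k, ⟪pd j (pd k u) x, pd i (lap u) x⟫ = ⟪pd i (lap u) x, pd j (pd k u) x⟫ :=
    fun i j k => real_inner_comm _ _
  have s3 : ∀ i, ⟪lap u x, pd i (lap u) x⟫ = ⟪pd i (lap u) x, lap u x⟫ :=
    fun i => real_inner_comm _ _
  simp only [← real_inner_self_eq_norm_sq, s1, s2, s3, d]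
  linear_combination (-x 0) * e0 - x 1 * e1

/-! ### The logarithmic radial weight -/

/-- The logarithmic cutoff `log q − log |x|`, frozen at `|x| = p` inside and at `|x| = q`
outside. -/
def logWeight (p q : ℝ) (x : E2) : ℝ := Real.log q - Real.log (max p (min ‖x‖ q))

lemma lipschitzWith_logWeight {p q : ℝ} (hp : 0 < p) :
    LipschitzWith (Real.toNNReal p⁻¹) (logWeight p q) := by
  have h1 : LipschitzWith 1 (fun x : E2 => max p (min ‖x‖ q)) :=
    (lipschitzWith_one_norm.min_const q).const_max p
  have hlog : ∀ a b : ℝ, p ≤ a → p ≤ b → Real.log a - Real.log b ≤ p⁻¹ * |a - b| := by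
    intro a b ha hb
    have ha0 := hp.trans_le ha
    have hb0 := hp.trans_le hb
    rw [← Real.log_div ha0.ne' hb0.ne']
    calc Real.log (a / b) ≤ a / b - 1 := Real.log_le_sub_one_of_pos (by positivity)
      _ = b⁻¹ * (a - b) := by field_simp
      _ ≤ b⁻¹ * |a - b| := by gcongr; exact le_abs_self _
      _ ≤ p⁻¹ * |a - b| := by gcongr
  refine LipschitzWith.of_dist_le_mul fun x y => ?_
  rw [Real.coe_toNNReal _ (by positivity)]
  have h2 := h1.dist_le_mul x y
  rw [NNReal.coe_one, one_mul, Real.dist_eq] at h2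
  refine le_trans ?_ (mul_le_mul_of_nonneg_left h2 (by positivity))
  have hx := hlog _ _ (le_max_left p (min ‖x‖ q)) (le_max_left p (min ‖y‖ q))
  have hy := hlog _ _ (le_max_left p (min ‖y‖ q)) (le_max_left p (min ‖x‖ q))
  rw [abs_sub_comm] at hy
  rw [Real.dist_eq, logWeight, logWeight, abs_le]
  constructor <;> linarith

lemma logWeight_of_le {p q : ℝ} (hpq : p < q) {x : E2} (hx : q ≤ ‖x‖) : logWeight p q x = 0 := by
  simp [logWeight, hx, hpq.le]

lemma hasCompactSupport_logWeight {p q : ℝ} (hpq : p < q) :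
    HasCompactSupport (logWeight p q) :=
  HasCompactSupport.intro (isCompact_closedBall (0 : E2) q) fun x hx => by
    rw [mem_closedBall_zero_iff, not_le] at hx
    exact logWeight_of_le hpq hx.le

lemma measurableSet_ann (p q : ℝ) : MeasurableSet (ann p q) :=
  (measurableSet_lt measurable_const measurable_norm).inter
    (measurableSet_lt measurable_norm measurable_const)

lemma hasFDerivAt_logWeight {p q : ℝ} (hp : 0 < p) {x : E2} (hx : x ∈ ann p q) :
    HasFDerivAt (logWeight p q) (-((‖x‖ ^ 2)⁻¹ • innerSL ℝ x)) x := by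
  have hx0 : 0 < ‖x‖ := hp.trans hx.1
  have h1 := ((hasStrictFDerivAt_norm_sq x).hasFDerivAt.log (by positivity)).const_mul (1 / 2 : ℝ)
  have h2 := h1.const_sub (Real.log q)
  have hopen : IsOpen (ann p q) :=
    (isOpen_lt continuous_const continuous_norm).inter (isOpen_lt continuous_norm continuous_const)
  have h3 : logWeight p q =ᶠ[nhds x] fun y => Real.log q - 1 / 2 * Real.log (‖y‖ ^ 2) := by
    filter_upwards [hopen.mem_nhds hx] with y hy
    rw [logWeight, min_eq_left hy.2.le, max_eq_right hy.1.le, Real.log_pow]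
    push_cast
    ring
  refine (h2.congr_of_eventuallyEq h3).congr_fderiv ?_
  ext v
  simp
  ring

lemma lineDeriv_logWeight {p q : ℝ} (hp : 0 < p) (hpq : p < q) (v x : E2) (hxp : ‖x‖ ≠ p)
    (hxq : ‖x‖ ≠ q) :
    lineDeriv ℝ (logWeight p q) x (-v)
      = (ann p q).indicator (fun x => (‖x‖ ^ 2)⁻¹ * ⟪x, v⟫) x := by
  by_cases hx : x ∈ ann p q
  · rw [Set.indicator_of_mem hx, ((hasFDerivAt_logWeight hp hx).hasLineDerivAt (-v)).lineDeriv]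
    simp
  rw [Set.indicator_of_notMem hx]
  have hloc : ∃ c : ℝ, logWeight p q =ᶠ[nhds x] fun _ => c := by
    rcases lt_or_gt_of_ne hxp with h | h
    · refine ⟨Real.log q - Real.log p, ?_⟩
      filter_upwards [(isOpen_lt continuous_norm continuous_const).mem_nhds h] with y hy
      have hy : ‖y‖ < p := hy
      rw [logWeight, min_eq_left (hy.trans hpq).le, max_eq_left hy.le]
    · have h' : q < ‖x‖ := lt_of_le_of_ne (not_lt.1 fun h' => hx ⟨h, h'⟩) (Ne.symm hxq)
      refine ⟨0, ?_⟩
      filter_upwards [(isOpen_lt continuous_const continuous_norm).mem_nhds h'] with y hy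
      exact logWeight_of_le hpq (le_of_lt hy)
  obtain ⟨c, hc⟩ := hloc
  have := (((hasFDerivAt_const (𝕜 := ℝ) c x).congr_of_eventuallyEq hc).hasLineDerivAt (-v)).lineDeriv
  simpa using this

/-- Integration by parts against the logarithmic weight. -/
lemma integral_lineDeriv_mul_logWeight {p q : ℝ} (hp : 0 < p) (hpq : p < q) {f : E2 → ℝ}
    (hf : ContDiff ℝ (⊤ : ℕ∞) f) (hc : HasCompactSupport f) (α : Fin 2) :
    ∫ x, lineDeriv ℝ f x (EuclideanSpace.single α 1) * logWeight p q x
      = ∫ x in ann p q, (‖x‖ ^ 2)⁻¹ * x α * f x := by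
  obtain ⟨C, hC⟩ := hf.lipschitzWith_of_hasCompactSupport hc (by simp)
  rw [hC.integral_lineDeriv_mul_eq (lipschitzWith_logWeight hp) (hasCompactSupport_logWeight hpq),
    ← integral_indicator (measurableSet_ann p q)]
  have hs : ∀ r : ℝ, 0 < r → ∀ᵐ x : E2, ‖x‖ ≠ r := fun r hr => by
    have : volume (sphere (0 : E2) r) = 0 := Measure.addHaar_sphere _ _ _
    filter_upwards [compl_mem_ae_iff.2 this] with x hx
    simpa using hx
  refine integral_congr_ae ?_
  filter_upwards [hs p hp, hs q (hp.trans hpq)] with x h1 h2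
  rw [lineDeriv_logWeight hp hpq _ x h1 h2]
  by_cases hx : x ∈ ann p q
  · simp [hx, EuclideanSpace.inner_single_right]
  · simp [hx]

/-- Fubini: averaging ball integrals over the radius against `dt / t` produces the logarithmic
weight. -/
lemma integral_inv_mul_integral_ball {p q : ℝ} (hp : 0 < p) (hpq : p < q) {g : E2 → ℝ}
    (hg : Integrable g) :
    ∫ t in p..q, t⁻¹ * (∫ x in ball (0 : E2) t, g x) = ∫ x, g x * logWeight p q x := by
  have hmeas : MeasurableSet {z : ℝ × E2 | ‖z.2‖ < z.1} :=
    measurableSet_lt measurable_snd.norm measurable_fst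
  have hinv : IntegrableOn (fun t : ℝ => t⁻¹) (Set.Ioc p q) := by
    refine (ContinuousOn.integrableOn_Icc ?_).mono_set Set.Ioc_subset_Icc_self
    exact continuousOn_id.inv₀ fun t ht => (hp.trans_le ht.1).ne'
  have hint : Integrable (Function.uncurry fun (t : ℝ) (x : E2) =>
      {z : ℝ × E2 | ‖z.2‖ < z.1}.indicator (fun z => z.1⁻¹ * g z.2) (t, x))
      ((volume.restrict (Set.Ioc p q)).prod volume) :=
    (Integrable.mul_prod hinv hg).indicator hmeas
  rw [intervalIntegral.integral_of_le hpq.le]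
  calc ∫ t in Set.Ioc p q, t⁻¹ * (∫ x in ball (0 : E2) t, g x)
      = ∫ t in Set.Ioc p q, ∫ x : E2,
          {z : ℝ × E2 | ‖z.2‖ < z.1}.indicator (fun z => z.1⁻¹ * g z.2) (t, x) := by
        refine integral_congr_ae (Eventually.of_forall fun t => ?_)
        simp only
        rw [← integral_const_mul, ← integral_indicator measurableSet_ball]
        refine integral_congr_ae (Eventually.of_forall fun x => ?_)
        by_cases h : ‖x‖ < t <;> simp [h]
    _ = ∫ x : E2, ∫ t in Set.Ioc p q,
          {z : ℝ × E2 | ‖z.2‖ < z.1}.indicator (fun z => z.1⁻¹ * g z.2) (t, x) :=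
        integral_integral_swap hint
    _ = ∫ x, g x * logWeight p q x := by
        refine integral_congr_ae (Eventually.of_forall fun x => ?_)
        simp only
        set m := max p (min ‖x‖ q) with hm
        have hpm : p ≤ m := le_max_left _ _
        have hmq : m ≤ q := max_le hpq.le (min_le_right _ _)
        have hset : Set.Ioc p q ∩ {t | ‖x‖ < t} = Set.Ioc m q := by
          ext t
          simp only [Set.mem_inter_iff, Set.mem_Ioc, Set.mem_ofPred_eq, hm, max_lt_iff,
            min_lt_iff]
          constructor
          · rintro ⟨⟨h1, h2⟩, h3⟩
            exact ⟨⟨h1, Or.inl h3⟩, h2⟩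
          · rintro ⟨⟨h1, h3⟩, h2⟩
            exact ⟨⟨h1, h2⟩, h3.resolve_right h2.not_gt⟩
        have heq : (fun t : ℝ =>
            {z : ℝ × E2 | ‖z.2‖ < z.1}.indicator (fun z => z.1⁻¹ * g z.2) (t, x))
            = {t : ℝ | ‖x‖ < t}.indicator fun t => t⁻¹ * g x := by
          ext t
          simp [Set.indicator_apply]
        rw [heq, setIntegral_indicator (measurableSet_lt measurable_const measurable_id'), hset,
          integral_mul_const, ← intervalIntegral.integral_of_le hmq,
          integral_inv_of_pos (hp.trans_le hpm) (hp.trans hpq),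
          Real.log_div (hp.trans hpq).ne' (hp.trans_le hpm).ne', mul_comm, logWeight]

/-! ### The identity on annuli -/

/-- On `x ≠ 0`, the normal component of the Pohozaev field, divided by `|x|²`. -/
lemma pohozaevField_normal {l : ℕ} (ε : ℝ) (u : E2 → Eu l) {x : E2} (hx : x ≠ 0) :
    2 * ((‖x‖ ^ 2)⁻¹ * x 0 * pohozaevField ε u 0 x + (‖x‖ ^ 2)⁻¹ * x 1 * pohozaevField ε u 1 x)
      = 2 * (‖x‖⁻¹ ^ 2 * ‖angularDeriv u x‖ ^ 2) - gradSq u x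
        - 2 * ε * ((1 / 2) * ‖lap u x‖ ^ 2 + (∑ i : Fin 2, ⟪pd i u x, pd i (lap u) x⟫)
            - 2 * ⟪radialDeriv u x, radialDeriv (lap u) x⟫) := by
  have hn : ‖x‖ ^ 2 = x 0 ^ 2 + x 1 ^ 2 := by
    rw [EuclideanSpace.real_norm_sq_eq, Fin.sum_univ_two]
  have hn0 : x 0 ^ 2 + x 1 ^ 2 ≠ 0 := by rw [← hn]; positivity
  have hdir : ∀ (w : E2 → Eu l) (v : E2), fderiv ℝ w x v = v 0 • pd 0 w x + v 1 • pd 1 w x := by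
    intro w v
    have hv : v = v 0 • EuclideanSpace.single 0 (1 : ℝ) + v 1 • EuclideanSpace.single 1 (1 : ℝ) := by
      ext i
      fin_cases i <;> simp
    conv_lhs => rw [hv]
    rw [map_add, map_smul, map_smul]
    rfl
  have hang : angularDeriv u x = -(x 1) • pd 0 u x + x 0 • pd 1 u x := hdir u _
  have hrad : ∀ w : E2 → Eu l, radialDeriv w x = ‖x‖⁻¹ • (x 0 • pd 0 w x + x 1 • pd 1 w x) := by
    intro w
    rw [radialDeriv, map_smul, hdir]
  rw [hang, hrad, hrad, real_inner_smul_left, real_inner_smul_right]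
  simp only [pohozaevField, S1, S2, gradSq, Fin.sum_univ_two, ← real_inner_self_eq_norm_sq (pd _ u x),
    ← real_inner_self_eq_norm_sq (_ + _), inner_add_left, inner_add_right, real_inner_smul_left,
    real_inner_smul_right, real_inner_comm (pd 0 u x) (pd 1 u x), if_true, Fin.zero_eq_one_iff,
    Fin.one_eq_zero_iff, OfNat.ofNat_ne_one, if_false]
  have hr : ∀ a : ℝ, ‖x‖⁻¹ * (‖x‖⁻¹ * a) = (x 0 ^ 2 + x 1 ^ 2)⁻¹ * a := by
    intro a
    rw [← hn]
    ring
  rw [hr, inv_pow, hn]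
  field_simp
  ring

lemma integrableOn_ann_of_continuousOn {p q : ℝ} (hp : 0 < p) {f : E2 → ℝ}
    (hf : ContinuousOn f {0}ᶜ) : IntegrableOn f (ann p q) := by
  have hK : IsCompact (closedBall (0 : E2) q \ ball 0 p) :=
    (isCompact_closedBall _ _).diff isOpen_ball
  refine (ContinuousOn.integrableOn_compact hK (hf.mono fun x hx => ?_)).mono_set fun x hx => ?_
  · rintro rfl
    exact hx.2 (mem_ball_self hp)
  · exact ⟨mem_closedBall_zero_iff.2 hx.2.le, fun h => hx.1.not_gt (mem_ball_zero_iff.1 h)⟩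

/-- The Pohozaev identity for globally smooth, compactly supported maps satisfying the stationarity
equation on a disk. -/
lemma pohozaev_annulus_of_hasCompactSupport {l : ℕ} {u : E2 → Eu l}
    (hu : ContDiff ℝ (⊤ : ℕ∞) u) (hc : HasCompactSupport u) (ε : ℝ) {p q : ℝ} (hp : 0 < p)
    (hpq : p < q)
    (heq : ∀ x ∈ ball (0 : E2) q, ∀ α, ⟪pd α u x, lap u x - ε • lap (lap u) x⟫ = 0) :
    ∫ x in ann p q, gradSq u x =
      2 * (∫ x in ann p q, ‖x‖⁻¹ ^ 2 * ‖angularDeriv u x‖ ^ 2)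
        + 2 * ε * (∫ t in p..q, t⁻¹ * (∫ x in Metric.ball (0 : E2) t, ‖lap u x‖ ^ 2))
        - 2 * ε * (∫ x in ann p q,
            (1 / 2) * ‖lap u x‖ ^ 2 + (∑ i : Fin 2, ⟪pd i u x, pd i (lap u) x⟫)
              - 2 * ⟪radialDeriv u x, radialDeriv (lap u) x⟫) := by
  have hL := contDiff_lap hu
  have hF := contDiff_pohozaevField hu ε
  have hFc := hasCompactSupport_pohozaevField hc ε
  have hLint : Integrable fun x => ‖lap u x‖ ^ 2 := by
    refine (hL.continuous.norm.pow 2).integrable_of_hasCompactSupport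
      (HasCompactSupport.intro hc fun x hx => ?_)
    simp [lap_eq_zero_of_notMem_tsupport hx]
  have hnorm : ContinuousOn (fun x : E2 => ‖x‖⁻¹) {0}ᶜ :=
    continuous_norm.continuousOn.inv₀ fun x hx => norm_ne_zero_iff.2 hx
  have hpd : ∀ {w : E2 → Eu l}, ContDiff ℝ (⊤ : ℕ∞) w → ∀ i, Continuous (pd i w) :=
    fun hw i => (contDiff_pd hw i).continuous
  have hfd : ∀ {w : E2 → Eu l}, ContDiff ℝ (⊤ : ℕ∞) w → Continuous (fderiv ℝ w) :=
    fun hw => hw.continuous_fderiv (by simp)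
  have hgrad : IntegrableOn (gradSq u) (ann p q) :=
    integrableOn_ann_of_continuousOn hp
      (((hpd hu 0).norm.pow 2).add ((hpd hu 1).norm.pow 2)).continuousOn
  have hang : IntegrableOn (fun x => ‖x‖⁻¹ ^ 2 * ‖angularDeriv u x‖ ^ 2) (ann p q) := by
    refine integrableOn_ann_of_continuousOn hp ((hnorm.pow 2).mul
      (Continuous.continuousOn (((hfd hu).clm_apply ?_).norm.pow 2)))
    refine (PiLp.continuous_toLp 2 _).comp (continuous_pi fun i => ?_)
    fin_cases i <;> simp <;> fun_prop
  have hrad : ∀ {w : E2 → Eu l}, ContDiff ℝ (⊤ : ℕ∞) w →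
      ContinuousOn (radialDeriv w) {0}ᶜ :=
    fun hw => (hfd hw).continuousOn.clm_apply (hnorm.smul continuousOn_id)
  have hrem : IntegrableOn (fun x => (1 / 2) * ‖lap u x‖ ^ 2
      + (∑ i : Fin 2, ⟪pd i u x, pd i (lap u) x⟫)
      - 2 * ⟪radialDeriv u x, radialDeriv (lap u) x⟫) (ann p q) := by
    refine integrableOn_ann_of_continuousOn hp (ContinuousOn.sub (Continuous.continuousOn ?_)
      (continuousOn_const.mul ((hrad hu).inner (hrad hL))))
    exact (continuous_const.mul (hL.continuous.norm.pow 2)).add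
      (continuous_finsetSum _ fun i _ => (hpd hu i).inner (hpd hL i))
  have hflux : ∀ α : Fin 2, IntegrableOn
      (fun x => (‖x‖ ^ 2)⁻¹ * x α * pohozaevField ε u α x) (ann p q) := fun α => by
    refine integrableOn_ann_of_continuousOn hp (ContinuousOn.mul (ContinuousOn.mul ?_ ?_)
      (hF α).continuous.continuousOn)
    · exact (hnorm.pow 2).congr fun x _ => by simp
    · exact Continuous.continuousOn (by fun_prop)
  have hdiv : ∀ α : Fin 2, Integrable fun x =>
      lineDeriv ℝ (pohozaevField ε u α) x (EuclideanSpace.single α 1) * logWeight p q x := by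
    intro α
    have h1 : (fun x => lineDeriv ℝ (pohozaevField ε u α) x (EuclideanSpace.single α 1))
        = fun x => fderiv ℝ (pohozaevField ε u α) x (EuclideanSpace.single α 1) :=
      funext fun x => (((hF α).differentiable (by simp)) x).lineDeriv_eq_fderiv
    have h2 : Continuous fun x =>
        lineDeriv ℝ (pohozaevField ε u α) x (EuclideanSpace.single α 1) := by
      rw [h1]
      exact ((hF α).continuous_fderiv (by simp)).clm_apply continuous_const
    exact (h2.mul (lipschitzWith_logWeight hp).continuous).integrable_of_hasCompactSupport
      (hasCompactSupport_logWeight hpq).mul_left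
  have hparts : ∫ x in ann p q, ((‖x‖ ^ 2)⁻¹ * x 0 * pohozaevField ε u 0 x
        + (‖x‖ ^ 2)⁻¹ * x 1 * pohozaevField ε u 1 x)
      = -ε * ∫ x, ‖lap u x‖ ^ 2 * logWeight p q x := by
    rw [integral_add (hflux 0) (hflux 1),
      ← integral_lineDeriv_mul_logWeight hp hpq (hF 0) (hFc 0) 0,
      ← integral_lineDeriv_mul_logWeight hp hpq (hF 1) (hFc 1) 1,
      ← integral_add (hdiv 0) (hdiv 1), ← integral_const_mul]
    refine integral_congr_ae (Eventually.of_forall fun x => ?_)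
    simp only
    rcases lt_or_ge ‖x‖ q with h | h
    · rw [← add_mul, lineDeriv_pohozaevField_add hu ε x (heq x (mem_ball_zero_iff.2 h)), mul_assoc]
    · simp [logWeight_of_le hpq h]
  rw [integral_inv_mul_integral_ball hp hpq hLint]
  have hnormal : 2 * ∫ x in ann p q, ((‖x‖ ^ 2)⁻¹ * x 0 * pohozaevField ε u 0 x
        + (‖x‖ ^ 2)⁻¹ * x 1 * pohozaevField ε u 1 x)
      = 2 * (∫ x in ann p q, ‖x‖⁻¹ ^ 2 * ‖angularDeriv u x‖ ^ 2)
        - (∫ x in ann p q, gradSq u x)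
        - 2 * ε * (∫ x in ann p q,
            (1 / 2) * ‖lap u x‖ ^ 2 + (∑ i : Fin 2, ⟪pd i u x, pd i (lap u) x⟫)
              - 2 * ⟪radialDeriv u x, radialDeriv (lap u) x⟫) := by
    have hdiff : IntegrableOn
        (fun x => 2 * (‖x‖⁻¹ ^ 2 * ‖angularDeriv u x‖ ^ 2) - gradSq u x) (ann p q) :=
      (hang.const_mul 2).sub hgrad
    rw [← integral_const_mul, ← integral_const_mul, ← integral_const_mul,
      ← integral_sub (hang.const_mul 2) hgrad,
      ← integral_sub hdiff (hrem.const_mul (2 * ε))]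
    refine setIntegral_congr_fun (measurableSet_ann p q) fun x hx => ?_
    exact pohozaevField_normal ε u (norm_pos_iff.1 (hp.trans hx.1))
  rw [hparts] at hnormal
  linear_combination hnormal

lemma pd_congr {l : ℕ} {u v : E2 → Eu l} {U : Set E2} (hU : IsOpen U) (h : Set.EqOn u v U)
    (α : Fin 2) : Set.EqOn (pd α u) (pd α v) U := fun x hx => by
  rw [pd, pd, (h.eventuallyEq_of_mem (hU.mem_nhds hx)).fderiv_eq]

lemma lap_congr {l : ℕ} {u v : E2 → Eu l} {U : Set E2} (hU : IsOpen U) (h : Set.EqOn u v U) :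
    Set.EqOn (lap u) (lap v) U := fun x hx => by
  rw [lap, lap, pd_congr hU (pd_congr hU h 0) 0 hx, pd_congr hU (pd_congr hU h 1) 1 hx]

/-- The derivatives of a sphere-valued map are tangent to the sphere. -/
lemma inner_pd_eq_zero_of_norm_eq_one {l : ℕ} {u : E2 → Eu l} (hu : ContDiff ℝ (⊤ : ℕ∞) u)
    {U : Set E2} (hU : IsOpen U) (h : ∀ x ∈ U, ‖u x‖ = 1) {x : E2} (hx : x ∈ U) (α : Fin 2) :
    ⟪pd α u x, u x⟫ = 0 := by
  have h1 := (((hu.differentiable (by simp)) x).hasFDerivAt.norm_sq).congr_of_eventuallyEq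
    (f₁ := fun _ => (1 : ℝ)) (by
      filter_upwards [hU.mem_nhds hx] with y hy
      simp [h y hy])
  have h2 := congrArg (fun L => L (EuclideanSpace.single α (1 : ℝ)))
    (h1.unique (hasFDerivAt_const (1 : ℝ) x))
  simpa [pd, real_inner_comm] using h2

/-- A smooth map on a neighbourhood of the closed unit disk agrees on any smaller disk with a
globally smooth, compactly supported one. -/
lemma exists_contDiff_hasCompactSupport_eqOn_ball {l : ℕ} {Ω : Set E2} (hΩ : IsOpen Ω)
    (hball : closedBall (0 : E2) 1 ⊆ Ω) {u : E2 → Eu l} (hu : ContDiffOn ℝ (⊤ : ℕ∞) u Ω)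
    {q : ℝ} (hq0 : 0 < q) (hq : q < 1) :
    ∃ v : E2 → Eu l, ContDiff ℝ (⊤ : ℕ∞) v ∧ HasCompactSupport v ∧ Set.EqOn u v (ball 0 q) := by
  let χ : ContDiffBump (0 : E2) := ⟨q, 1, hq0, hq⟩
  refine ⟨fun x => χ x • u x, contDiff_iff_contDiffAt.2 fun x => ?_, ?_, fun x hx => ?_⟩
  · by_cases hx : x ∈ closedBall (0 : E2) 1
    · exact χ.contDiffAt.smul (hu.contDiffAt (hΩ.mem_nhds (hball hx)))
    · have : (fun x => χ x • u x) =ᶠ[nhds x] fun _ => 0 := by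
        filter_upwards [isClosed_closedBall.isOpen_compl.mem_nhds hx] with y hy
        have hy' : 1 < ‖y‖ := by simpa using hy
        rw [χ.zero_of_le_dist (by simpa using hy'.le), zero_smul]
      exact contDiffAt_const.congr_of_eventuallyEq this
  · exact χ.hasCompactSupport.smul_right
  · simp only
    rw [χ.one_of_mem_closedBall (ball_subset_closedBall hx), one_smul]

/-- integrated Pohozaev identity on annuli for a smooth sphere-valued
`ε`-harmonic map (`ε ≥ 0`) on a neighbourhood of the closed unit disk: for all `0 < p < q < 1`,
`∫_{A(p,q)} |∇u|² = 2∫_{A(p,q)} |x|⁻²|∂_θ u|² + 2ε ∫_p^q t⁻¹ (∫_{B_t} |Δu|²) dt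
  − 2ε ∫_{A(p,q)} (½|Δu|² + ∑_i ⟨∂_i u, ∂_i Δu⟩ − 2⟨∂_r u, ∂_r Δu⟩)`. -/
theorem pohozaev_annulus_eps_harmonic {l : ℕ} (Ω : Set E2) (hΩ : IsOpen Ω)
    (hball : Metric.closedBall (0 : E2) 1 ⊆ Ω)
    (ε : ℝ) (hε : 0 ≤ ε) (u : E2 → Eu l) (hu : ContDiffOn ℝ (⊤ : ℕ∞) u Ω)
    (hsph : ∀ x ∈ Ω, ‖u x‖ = 1) (hharm : IsEpsHarmonic ε Ω u)
    (p q : ℝ) (hp : 0 < p) (hpq : p < q) (hq : q < 1) :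
    ∫ x in ann p q, gradSq u x =
      2 * (∫ x in ann p q, ‖x‖⁻¹ ^ 2 * ‖angularDeriv u x‖ ^ 2)
        + 2 * ε * (∫ t in p..q, t⁻¹ * (∫ x in Metric.ball (0 : E2) t, ‖lap u x‖ ^ 2))
        - 2 * ε * (∫ x in ann p q,
            (1 / 2) * ‖lap u x‖ ^ 2 + (∑ i : Fin 2, ⟪pd i u x, pd i (lap u) x⟫)
              - 2 * ⟪radialDeriv u x, radialDeriv (lap u) x⟫) := by
  obtain ⟨v, hv, hvc, huv⟩ :=
    exists_contDiff_hasCompactSupport_eqOn_ball hΩ hball hu (hp.trans hpq) hq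
  have hU : IsOpen (ball (0 : E2) q) := isOpen_ball
  have hUΩ : ball (0 : E2) q ⊆ Ω := ((ball_subset_ball hq.le).trans ball_subset_closedBall).trans hball
  have hpd := pd_congr hU huv
  have hlap := lap_congr hU huv
  have hpdlap := pd_congr hU hlap
  have hfd : ∀ {w z : E2 → Eu l}, Set.EqOn w z (ball 0 q) →
      ∀ x ∈ ball (0 : E2) q, fderiv ℝ w x = fderiv ℝ z x :=
    fun h x hx => (h.eventuallyEq_of_mem (hU.mem_nhds hx)).fderiv_eq
  have hann : ∀ x ∈ ann p q, x ∈ ball (0 : E2) q := fun x hx => mem_ball_zero_iff.2 hx.2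
  have key := pohozaev_annulus_of_hasCompactSupport hv hvc ε hp hpq fun x hx α => by
    obtain ⟨c, hc⟩ := hharm x (hUΩ hx)
    rw [← hlap hx, ← lap_congr hU hlap hx, hc, huv hx, inner_smul_right,
      inner_pd_eq_zero_of_norm_eq_one hv hU (fun y hy => huv hy ▸ hsph y (hUΩ hy)) hx α, mul_zero]
  have h1 : ∫ x in ann p q, gradSq u x = ∫ x in ann p q, gradSq v x :=
    setIntegral_congr_fun (measurableSet_ann p q) fun x hx => by
      simp only [gradSq, hpd _ (hann x hx)]
  have h2 : ∫ x in ann p q, ‖x‖⁻¹ ^ 2 * ‖angularDeriv u x‖ ^ 2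
      = ∫ x in ann p q, ‖x‖⁻¹ ^ 2 * ‖angularDeriv v x‖ ^ 2 :=
    setIntegral_congr_fun (measurableSet_ann p q) fun x hx => by
      simp only [angularDeriv, hfd huv x (hann x hx)]
  have h3 : ∫ t in p..q, t⁻¹ * (∫ x in ball (0 : E2) t, ‖lap u x‖ ^ 2)
      = ∫ t in p..q, t⁻¹ * (∫ x in ball (0 : E2) t, ‖lap v x‖ ^ 2) := by
    refine intervalIntegral.integral_congr fun t ht => ?_
    rw [Set.uIcc_of_le hpq.le] at ht
    congr 1
    refine setIntegral_congr_fun measurableSet_ball fun x hx => ?_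
    simp only [hlap (ball_subset_ball ht.2 hx)]
  have h4 : ∫ x in ann p q, ((1 / 2) * ‖lap u x‖ ^ 2
        + (∑ i : Fin 2, ⟪pd i u x, pd i (lap u) x⟫)
        - 2 * ⟪radialDeriv u x, radialDeriv (lap u) x⟫)
      = ∫ x in ann p q, ((1 / 2) * ‖lap v x‖ ^ 2
        + (∑ i : Fin 2, ⟪pd i v x, pd i (lap v) x⟫)
        - 2 * ⟪radialDeriv v x, radialDeriv (lap v) x⟫) :=
    setIntegral_congr_fun (measurableSet_ann p q) fun x hx => by
      simp only [radialDeriv, hfd huv x (hann x hx), hfd hlap x (hann x hx), hlap (hann x hx),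
        hpd _ (hann x hx), hpdlap _ (hann x hx)]
  rw [h1, h2, h3, h4, key]

end
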